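/- arXiv:1804.10079 — 2 statements merged into one kernel-verified Lean document; each statement's English description precedes it below -/
import Mathlib

section
/- (Lemma 5.6, finite moments of inverse Gram matrices.) Let A ∈ ℝ^{m×n} be a random matrix with m ≥ n, such that P[‖A‖_F > C] = 0 for some constant C (where ‖·‖_F is the Frobenius norm), and such that A has a probability density function that is bounded: sup_{A ∈ ℝ^{m×n}} pdf[A] < +∞. Then (AᵀA)⁻¹ has a finite p-th moment for every p < (m − n + 1)/2, i.e. E[‖(AᵀA)⁻¹‖₂^p] < ∞, where ‖·‖₂ is the induced L2 norm for matrices. -/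
open MeasureTheory Matrix

noncomputable instance {k l : Type*} [Fintype k] [Fintype l] : MeasureSpace (Matrix k l ℝ) :=
  (inferInstance : MeasureSpace (k → l → ℝ))

/-- Frobenius norm of a real matrix. -/
noncomputable def frobNorm {k l : Type*} [Fintype k] [Fintype l]
    (A : Matrix k l ℝ) : ℝ :=
  Real.sqrt (∑ i, ∑ j, (A i j) ^ 2)

/-- Induced L2 (spectral) norm of a square real matrix. -/
noncomputable def specNorm {n : ℕ} (M : Matrix (Fin n) (Fin n) ℝ) : ℝ :=
  ‖Matrix.toEuclideanCLM (𝕜 := ℝ) M‖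

open scoped ENNReal

lemma aux_lintegral_prod : ∀ (m : ℕ) (f : Fin m → ℝ → ℝ≥0∞), (∀ i, Measurable (f i)) →
    ∫⁻ x : Fin m → ℝ, ∏ i, f i (x i) = ∏ i, ∫⁻ t, f i t := by
  intro m
  induction m with
  | zero => intro f hf; simp [volume_pi]
  | succ m ih =>
    intro f hf
    have h := ((volume_preserving_piFinSuccAbove (fun _ : Fin (m+1) => ℝ) 0).symm).lintegral_comp
      (f := fun x : Fin (m+1) → ℝ => ∏ i, f i (x i)) (by fun_prop)
    rw [← h, Measure.volume_eq_prod]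
    simp only [MeasurableEquiv.piFinSuccAbove_symm_apply, Fin.insertNthEquiv, Fin.prod_univ_succ,
      Fin.insertNth_zero, Equiv.coe_fn_mk, Fin.cons_succ, Fin.cons_zero]
    have hm : Measurable (fun x : Fin m → ℝ => ∏ i : Fin m, f i.succ (x i)) :=
      Finset.measurable_prod _ fun i _ => (hf i.succ).comp (measurable_pi_apply i)
    have h5 := lintegral_prod_mul (μ := (volume : Measure ℝ)) (ν := (volume : Measure (Fin m → ℝ)))
      (hf 0).aemeasurable hm.aemeasurable
    rw [ih (fun i => f i.succ) (fun i => hf _)] at h5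
    exact h5

lemma aux_one_dim (R s : ℝ) (hs : s < 1) :
    ∫⁻ t : ℝ, (Set.Icc (-R) R).indicator (fun t => (ENNReal.ofReal |t|) ^ (-s)) t < ⊤ := by
  rw [lintegral_indicator measurableSet_Icc]
  have h : IntegrableOn (fun x : ℝ => |x| ^ (-s)) (Set.Icc (-R) R) := by
    by_cases hR : 0 ≤ R
    · have h1 : IntegrableOn (fun x : ℝ => |x| ^ (-s)) (Set.Ioc 0 R) := by
        have := (intervalIntegral.intervalIntegrable_rpow' (a := 0) (b := R)
          (show -1 < -s by linarith))
        rw [intervalIntegrable_iff_integrableOn_Ioc_of_le hR] at this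
        refine this.congr_fun (fun x hx => ?_) measurableSet_Ioc
        simp only [abs_of_pos hx.1]
      have h2 : IntervalIntegrable (fun x : ℝ => |x| ^ (-s)) volume 0 R :=
        (intervalIntegrable_iff_integrableOn_Ioc_of_le hR).2 h1
      have h3 : IntervalIntegrable (fun x : ℝ => |x| ^ (-s)) volume (-R) 0 := by
        have := (IntervalIntegrable.iff_comp_neg (f := fun x : ℝ => |x| ^ (-s)) (a := 0) (b := R)).1 h2
        simpa using this.symm
      have := h3.trans h2
      rw [intervalIntegrable_iff_integrableOn_Icc_of_le (by linarith)] at this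
      exact this
    · rw [Set.Icc_eq_empty (by linarith)]; exact integrableOn_empty
  have h4 := h.2
  rw [hasFiniteIntegral_iff_ofReal (by filter_upwards with x using by positivity)] at h4
  refine lt_of_le_of_lt (le_of_eq ?_) h4
  apply lintegral_congr_ae
  have : ∀ᵐ x : ℝ ∂(volume.restrict (Set.Icc (-R) R)), x ≠ 0 := by
    apply ae_restrict_of_ae
    exact (measure_eq_zero_iff_ae_notMem.1 (Real.volume_singleton (a := 0)))
  filter_upwards [this] with x hx
  rw [ENNReal.ofReal_rpow_of_pos (abs_pos.2 hx)]

lemma aux_basis (m n : ℕ) (hmn : n < m) (B : Fin m → Fin n → ℝ) :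
    ∃ b : OrthonormalBasis (Fin m) ℝ (EuclideanSpace ℝ (Fin m)), 
      ∀ i : Fin m, (i : ℕ) < m - n → ∀ j, ∑ k, b i k * B k j = 0 := by
  classical
  let V : Submodule ℝ (EuclideanSpace ℝ (Fin m)) :=
    Submodule.span ℝ (Set.range (fun j : Fin n => WithLp.toLp 2 (fun k => B k j)))
  have hV : Module.finrank ℝ V ≤ n := by
    have := finrank_range_le_card (R := ℝ) (fun j : Fin n => (WithLp.toLp 2 (fun k => B k j) : EuclideanSpace ℝ (Fin m)))
    rw [Fintype.card_fin] at this
    exact this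
  have hVo : m - n ≤ Module.finrank ℝ Vᗮ := by
    have := Submodule.finrank_add_finrank_orthogonal V
    simp at this
    omega
  let u := stdOrthonormalBasis ℝ Vᗮ
  let v : Fin m → EuclideanSpace ℝ (Fin m) := fun i =>
    if h : (i : ℕ) < m - n then (u ⟨i, lt_of_lt_of_le h hVo⟩ : EuclideanSpace ℝ (Fin m)) else 0
  have hv : Orthonormal ℝ (({i : Fin m | (i : ℕ) < m - n}).domRestrict v) := by
    have h1 : Orthonormal ℝ (fun i => (u i : EuclideanSpace ℝ (Fin m))) :=
      u.orthonormal.comp_linearIsometry (Vᗮ).subtypeₗᵢ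
    have h2 := h1.comp (fun i : {i : Fin m | (i : ℕ) < m - n} => (⟨i.1, lt_of_lt_of_le i.2 hVo⟩ : Fin _))
      (by intro a b hab; simp at hab; exact Subtype.ext (Fin.ext hab))
    convert h2 using 1
    funext i
    have : ((i : Fin m) : ℕ) < m - n := i.2
    simp [v, Set.domRestrict, this]
  obtain ⟨b, hb⟩ := hv.exists_orthonormalBasis_extension_of_card_eq (by simp)
  refine ⟨b, fun i hi j => ?_⟩
  have h3 : b i ∈ Vᗮ := by
    rw [hb i hi]; simp only [v, hi, dif_pos]; exact Subtype.property _
  have h4 := (Submodule.mem_orthogonal V _).1 h3 (WithLp.toLp 2 (fun k => B k j)) (Submodule.subset_span ⟨j, rfl⟩)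
  simpa [PiLp.inner_apply] using h4

lemma aux_alg {m n : ℕ} (A : Matrix (Fin m) (Fin n) ℝ) (hdet : IsUnit (Aᵀ * A).det) :
    (Aᵀ * A)⁻¹ = (A * (Aᵀ * A)⁻¹)ᵀ * (A * (Aᵀ * A)⁻¹) := by
  have hs : ((Aᵀ * A)⁻¹)ᵀ = (Aᵀ * A)⁻¹ := by
    rw [Matrix.transpose_nonsing_inv]; simp
  rw [Matrix.transpose_mul, hs, Matrix.mul_assoc, ← Matrix.mul_assoc Aᵀ, Matrix.mul_nonsing_inv _ hdet,
    Matrix.mul_one]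

lemma aux_jj {m n : ℕ} (A : Matrix (Fin m) (Fin n) ℝ) (j : Fin n) (hdet : IsUnit (Aᵀ * A).det) :
    (Aᵀ * A)⁻¹ j j = ∑ k, (A * (Aᵀ * A)⁻¹) k j ^ 2 := by
  conv_lhs => rw [aux_alg A hdet]
  rw [Matrix.mul_apply]
  simp [pow_two]

lemma aux_nonneg {m n : ℕ} (A : Matrix (Fin m) (Fin n) ℝ) (j : Fin n) :
    0 ≤ (Aᵀ * A)⁻¹ j j := by
  by_cases hdet : IsUnit (Aᵀ * A).det
  · rw [aux_jj A j hdet]; positivity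
  · rw [Matrix.nonsing_inv_apply_not_isUnit _ hdet]; simp

lemma aux_key {m n : ℕ} (A : Matrix (Fin m) (Fin n) ℝ) (j : Fin n) 
    (b : Fin m → ℝ) (hb : ∑ k, b k ^ 2 ≤ 1) (hort : ∀ i, i ≠ j → ∑ k, b k * A k i = 0) :
    (Aᵀ * A)⁻¹ j j * (∑ k, b k * A k j) ^ 2 ≤ 1 := by
  by_cases hdet : IsUnit (Aᵀ * A).det
  swap
  · rw [Matrix.nonsing_inv_apply_not_isUnit _ hdet]; simp
  set t := (Aᵀ * A)⁻¹ j j with ht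
  have h0 : 0 ≤ t := aux_nonneg A j
  have h1 : ∑ k, b k * (A * (Aᵀ * A)⁻¹) k j = t * ∑ k, b k * A k j := by
    simp only [Matrix.mul_apply, Finset.mul_sum]
    rw [Finset.sum_comm, Finset.sum_eq_single j]
    · exact Finset.sum_congr rfl fun k _ => by rw [ht]; ring
    · intro i _ hij
      have := hort i hij
      calc _ = (∑ k, b k * A k i) * (Aᵀ * A)⁻¹ i j := by
            rw [Finset.sum_mul]
            exact Finset.sum_congr rfl fun k _ => by ring
        _ = 0 := by rw [this, zero_mul]
    · simp
  have h2 := Finset.sum_mul_sq_le_sq_mul_sq Finset.univ b (fun k => (A * (Aᵀ * A)⁻¹) k j)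
  rw [h1, ← aux_jj A j hdet, ← ht] at h2
  have h3 : (t * ∑ k, b k * A k j) ^ 2 ≤ t := h2.trans (mul_le_of_le_one_left h0 hb)
  rcases h0.eq_or_lt with h | h
  · rw [← h]; simp
  · have : t * (t * (∑ k, b k * A k j) ^ 2) ≤ t * 1 := by nlinarith
    exact le_of_mul_le_mul_left this h

lemma aux_spec_le {m n : ℕ} (B : Matrix (Fin m) (Fin n) ℝ) :
    specNorm (Bᵀ * B) ≤ n * ∑ j, ∑ k, B k j ^ 2 := by
  have hpos : (0:ℝ) ≤ n * ∑ j, ∑ k, B k j ^ 2 := by positivity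
  have hent : ∀ i j, |(Bᵀ * B) i j| ≤ ∑ k, (B k i ^ 2 + B k j ^ 2) / 2 := by
    intro i j
    rw [Matrix.mul_apply]
    refine (Finset.abs_sum_le_sum_abs _ _).trans (Finset.sum_le_sum fun k _ => ?_)
    rw [Matrix.transpose_apply, abs_le]
    constructor <;> nlinarith [sq_nonneg (B k i + B k j), sq_nonneg (B k i - B k j)]
  refine ContinuousLinearMap.opNorm_le_bound _ hpos fun x => ?_
  have h1 : ∀ y : EuclideanSpace ℝ (Fin n), ‖y‖ ≤ ∑ i, |y i| := by
    intro y
    rw [EuclideanSpace.norm_eq]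
    refine Real.sqrt_le_iff.2 ⟨by positivity, ?_⟩
    simp only [Real.norm_eq_abs]
    exact Finset.sum_sq_le_sq_sum_of_nonneg (fun i _ => abs_nonneg _)
  refine (h1 _).trans ?_
  have h2 : ∀ i, |(Matrix.toEuclideanCLM (𝕜 := ℝ) (Bᵀ * B) x) i| ≤ ∑ j, (∑ k, (B k i ^ 2 + B k j ^ 2) / 2) * ‖x‖ := by
    intro i
    rw [Matrix.ofLp_toEuclideanCLM, Matrix.mulVec, dotProduct]
    refine (Finset.abs_sum_le_sum_abs _ _).trans (Finset.sum_le_sum fun j _ => ?_)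
    rw [abs_mul]
    exact mul_le_mul (hent i j) (PiLp.norm_apply_le x j) (abs_nonneg _) (by positivity)
  refine (Finset.sum_le_sum fun i _ => h2 i).trans (le_of_eq ?_)
  simp only [← Finset.sum_mul]
  congr 1
  simp only [add_div, Finset.sum_add_distrib, Finset.sum_const, Finset.card_univ, Fintype.card_fin, nsmul_eq_mul, ← Finset.sum_div, ← Finset.mul_sum]
  ring

lemma aux_meas {m n : ℕ} (i j : Fin n) :
    Measurable (fun A : Fin m → Fin n → ℝ => ((Matrix.of A)ᵀ * Matrix.of A)⁻¹ i j) := by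
  have hc : Continuous (fun A : Fin m → Fin n → ℝ => (Matrix.of A)ᵀ * Matrix.of A) := by
    have h : Continuous (fun A : Fin m → Fin n → ℝ => Matrix.of A) := continuous_id
    exact h.matrix_transpose.matrix_mul h
  have h1 : Continuous (fun A : Fin m → Fin n → ℝ => ((Matrix.of A)ᵀ * Matrix.of A).det) :=
    hc.matrix_det
  have h2 : Continuous (fun A : Fin m → Fin n → ℝ => ((Matrix.of A)ᵀ * Matrix.of A).adjugate i j) :=
    hc.matrix_adjugate.matrix_elem i j
  simp only [Matrix.inv_def, Matrix.smul_apply, Ring.inverse_eq_inv', smul_eq_mul]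
  exact h1.measurable.inv.mul h2.measurable

lemma aux_pt {m n : ℕ} (hmn : n < m) (p : ℝ) (hp : 0 < p) (C : ℝ) (B : Fin m → Fin n → ℝ)
    (j : Fin (n+1)) (b : OrthonormalBasis (Fin m) ℝ (EuclideanSpace ℝ (Fin m)))
    (hb : ∀ i : Fin m, (i : ℕ) < m - n → ∀ j, ∑ k, b i k * B k j = 0) (c : Fin m → ℝ)
    (hc : ∑ k, c k ^ 2 ≤ C ^ 2) (A : Matrix (Fin m) (Fin (n+1)) ℝ)
    (hA1 : ∀ k, A k j = c k) (hA2 : ∀ k i, A k (j.succAbove i) = B k i) :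
    ENNReal.ofReal ((Aᵀ * A)⁻¹ j j) ^ p ≤
      ∏ i : Fin m, (Set.Icc (-|C|) |C|).indicator (fun t => (ENNReal.ofReal |t|) ^
        (-(if (i : ℕ) < m - n then 2 * p / (m - n : ℕ) else 0))) (b.repr (WithLp.toLp 2 c) i) := by
  have hk : (0:ℝ) < (m - n : ℕ) := by exact_mod_cast Nat.sub_pos_of_lt hmn
  have hy : ∀ i, b.repr (WithLp.toLp 2 c) i = ∑ k, b i k * c k := by
    intro i
    rw [OrthonormalBasis.repr_apply_apply, PiLp.inner_apply]
    simp [mul_comm]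
  have hb1 : ∀ i, ∑ k, b i k ^ 2 = 1 := by
    intro i
    have := b.orthonormal.1 i
    rw [EuclideanSpace.norm_eq, Real.sqrt_eq_one] at this
    simpa using this
  have hprod : ENNReal.ofReal ((Aᵀ * A)⁻¹ j j) ^ p = ∏ i : Fin m,
      ENNReal.ofReal ((Aᵀ * A)⁻¹ j j) ^ (if (i : ℕ) < m - n then p / (m - n : ℕ) else 0) := by
    have : ∀ i : Fin m, ENNReal.ofReal ((Aᵀ * A)⁻¹ j j) ^ (if (i : ℕ) < m - n then p / (m - n : ℕ) else 0)
      = if (i : ℕ) < m - n then ENNReal.ofReal ((Aᵀ * A)⁻¹ j j) ^ (p / (m - n : ℕ)) else 1 := by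
      intro i; split_ifs <;> simp
    simp only [this]
    rw [Finset.prod_ite, Finset.prod_const, Finset.prod_const_one, mul_one]
    have hcard : (Finset.univ.filter (fun i : Fin m => (i : ℕ) < m - n)).card = m - n := by
      rw [Fin.card_filter_val_lt]; omega
    rw [hcard, ← ENNReal.rpow_natCast, ← ENNReal.rpow_mul, div_mul_cancel₀ _ hk.ne']
  rw [hprod]
  refine Finset.prod_le_prod' fun i _ => ?_
  have hmem : b.repr (WithLp.toLp 2 c) i ∈ Set.Icc (-|C|) |C| := by
    rw [Set.mem_Icc, ← abs_le, ← sq_le_sq, hy]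
    refine (Finset.sum_mul_sq_le_sq_mul_sq Finset.univ _ _).trans ?_
    rw [hb1, one_mul]; exact hc
  rw [Set.indicator_of_mem hmem]
  split_ifs with hi
  swap
  · simp
  have hkey := aux_key A j (fun k => b i k) (hb1 i).le (by
    intro l hl
    obtain ⟨l', rfl⟩ := Fin.exists_succAbove_eq hl
    simp only [hA2]
    exact hb i hi l')
  simp only [hA1] at hkey
  rw [← hy] at hkey
  set y := b.repr (WithLp.toLp 2 c) i
  set t := (Aᵀ * A)⁻¹ j j
  have ht : 0 ≤ t := aux_nonneg A j
  rw [show -(2 * p / ((m - n : ℕ):ℝ)) = (-2) * (p / ((m - n : ℕ):ℝ)) by ring, ENNReal.rpow_mul]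
  refine ENNReal.rpow_le_rpow ?_ (by positivity)
  rw [ENNReal.rpow_neg, ENNReal.le_inv_iff_mul_le]
  rw [show (2:ℝ) = ((2:ℕ):ℝ) by norm_num, ENNReal.rpow_natCast, ← ENNReal.ofReal_pow (abs_nonneg _), ← ENNReal.ofReal_mul ht, sq_abs]
  exact ENNReal.ofReal_le_one.2 hkey

lemma aux_col {m n : ℕ} (hmn : n < m) (p : ℝ) (hp : 0 < p) (hp2 : 2 * p < (m - n : ℕ)) (C : ℝ) :
    ∃ K : ℝ≥0∞, K < ⊤ ∧ ∀ (B : Fin m → Fin n → ℝ) (j : Fin (n+1)), 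
      ∫⁻ c : Fin m → ℝ, ({c : Fin m → ℝ | ∑ k, c k ^ 2 ≤ C ^ 2}).indicator (fun c =>
        ENNReal.ofReal (((Matrix.of fun k => j.insertNth (α := fun _ => ℝ) (c k) (B k))ᵀ * 
          (Matrix.of fun k => j.insertNth (α := fun _ => ℝ) (c k) (B k)))⁻¹ j j) ^ p) c ≤ K := by
  have hk : (0:ℝ) < (m - n : ℕ) := by exact_mod_cast Nat.sub_pos_of_lt hmn
  let φ : Fin m → ℝ → ℝ≥0∞ := fun i => (Set.Icc (-|C|) |C|).indicator (fun t => (ENNReal.ofReal |t|) ^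
        (-(if (i : ℕ) < m - n then 2 * p / (m - n : ℕ) else 0)))
  have hφ : ∀ i, Measurable (φ i) := by
    intro i
    refine Measurable.indicator ?_ measurableSet_Icc
    fun_prop
  refine ⟨∏ i, ∫⁻ t, φ i t, ?_, fun B j => ?_⟩
  · refine ENNReal.prod_lt_top fun i _ => ?_
    refine aux_one_dim _ _ ?_
    split_ifs
    · rwa [div_lt_one hk]
    · norm_num
  obtain ⟨b, hb⟩ := aux_basis m n hmn B
  have hmp : MeasurePreserving (fun c : Fin m → ℝ => WithLp.ofLp (b.repr (WithLp.toLp 2 c))) volume volume :=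
    (PiLp.volume_preserving_ofLp (Fin m)).comp (b.measurePreserving_repr.comp (PiLp.volume_preserving_toLp (Fin m)))
  have hprodm : Measurable (fun x : Fin m → ℝ => ∏ i, φ i (x i)) :=
      Finset.measurable_prod _ fun i _ => (hφ i).comp (measurable_pi_apply i)
  rw [← aux_lintegral_prod m φ hφ, ← hmp.lintegral_comp hprodm]
  refine lintegral_mono fun c => ?_
  by_cases hc : c ∈ {c : Fin m → ℝ | ∑ k, c k ^ 2 ≤ C ^ 2}
  swap
  · rw [Set.indicator_of_notMem hc]; exact bot_le
  rw [Set.indicator_of_mem hc]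
  exact aux_pt hmn p hp C B j b hb c hc _ (fun k => by simp) (fun k i => by simp)

lemma aux_main {m n : ℕ} (hmn : n < m) (p : ℝ) (hp : 0 < p) (hp2 : 2 * p < (m - n : ℕ)) (C : ℝ)
    (j : Fin (n+1)) :
    ∫⁻ A : Fin m → Fin (n+1) → ℝ, ({A : Fin m → Fin (n+1) → ℝ | ∀ i, ∑ k, A k i ^ 2 ≤ C ^ 2}).indicator
      (fun A => ENNReal.ofReal (((Matrix.of A)ᵀ * Matrix.of A)⁻¹ j j) ^ p) A < ⊤ := by
  obtain ⟨K, hK, hKb⟩ := aux_col hmn p hp hp2 C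
  have e0 := (volume_preserving_piFinSuccAbove (fun _ : Fin (n+1) => ℝ) j).symm
  have e1 := volume_preserving_pi (fun _ : Fin m => e0)
  have e2 := (volume_measurePreserving_arrowProdEquivProdArrow ℝ (Fin n → ℝ) (Fin m)).symm
  have e3 : MeasurePreserving (fun z : (Fin m → ℝ) × (Fin m → Fin n → ℝ) => 
      (fun k => j.insertNth (α := fun _ => ℝ) (z.1 k) (z.2 k) : Fin m → Fin (n+1) → ℝ)) volume volume := e1.comp e2
  have hS : MeasurableSet ({A : Fin m → Fin (n+1) → ℝ | ∀ i, ∑ k, A k i ^ 2 ≤ C ^ 2}) := by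
    simp only [Set.ofPred_forall]
    refine MeasurableSet.iInter fun i => measurableSet_le ?_ measurable_const
    fun_prop
  have hG : Measurable (({A : Fin m → Fin (n+1) → ℝ | ∀ i, ∑ k, A k i ^ 2 ≤ C ^ 2}).indicator
      (fun A => ENNReal.ofReal (((Matrix.of A)ᵀ * Matrix.of A)⁻¹ j j) ^ p)) :=
    ((aux_meas j j).ennreal_ofReal.pow_const p).indicator hS
  rw [← e3.lintegral_comp hG]
  refine lt_of_eq_of_lt (lintegral_prod_symm' _ (hG.comp e3.measurable)) ?_
  let T : Set (Fin m → Fin n → ℝ) := Set.Icc (fun _ _ => -|C|) (fun _ _ => |C|)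
  have hT : volume T < ⊤ := isCompact_Icc.measure_lt_top
  refine lt_of_le_of_lt (lintegral_mono (g := T.indicator fun _ => K) fun B => ?_) ?_
  · by_cases hB : B ∈ T
    · rw [Set.indicator_of_mem hB]
      refine le_trans (lintegral_mono fun c => ?_) (hKb B j)
      simp only [Function.comp_apply]
      by_cases hc : (fun k => j.insertNth (α := fun _ => ℝ) (c k) (B k) : Fin m → Fin (n+1) → ℝ) ∈
          ({A : Fin m → Fin (n+1) → ℝ | ∀ i, ∑ k, A k i ^ 2 ≤ C ^ 2})
      · have hc' : c ∈ {c : Fin m → ℝ | ∑ k, c k ^ 2 ≤ C ^ 2} := by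
          have := hc j
          simpa using this
        rw [Set.indicator_of_mem hc, Set.indicator_of_mem hc']
      · rw [Set.indicator_of_notMem hc]; exact bot_le
    · rw [Set.indicator_of_notMem hB]
      refine le_trans (lintegral_mono (g := fun _ => 0) fun c => ?_) (by simp)
      simp only [Function.comp_apply]
      rw [Set.indicator_of_notMem]
      intro hc
      refine hB ?_
      have : ∀ k i, |B k i| ≤ |C| := by
        intro k i
        have h1 := hc (j.succAbove i)
        simp only [Fin.insertNth_apply_succAbove] at h1
        rw [← sq_le_sq]
        exact (Finset.single_le_sum (f := fun k => B k i ^ 2) (fun k _ => sq_nonneg _) (Finset.mem_univ k)).trans h1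
      exact ⟨fun k i => (abs_le.1 (this k i)).1, fun k i => (abs_le.1 (this k i)).2⟩
  · rw [lintegral_indicator measurableSet_Icc, setLIntegral_const]
    exact ENNReal.mul_lt_top hK hT

lemma aux_spec_meas {n : ℕ} : Measurable (fun X : Fin n → Fin n → ℝ => specNorm (Matrix.of X)) := by
  let L : (Fin n → Fin n → ℝ) →ₗ[ℝ] (EuclideanSpace ℝ (Fin n) →L[ℝ] EuclideanSpace ℝ (Fin n)) :=
    { toFun := fun X => Matrix.toEuclideanCLM (𝕜 := ℝ) (Matrix.of X)
      map_add' := fun X Y => map_add (Matrix.toEuclideanCLM (𝕜 := ℝ)) (Matrix.of X) (Matrix.of Y)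
      map_smul' := fun c X => map_smul (Matrix.toEuclideanCLM (𝕜 := ℝ)) c (Matrix.of X) }
  have hL : Continuous L := L.continuous_of_finiteDimensional
  exact hL.norm.measurable

lemma aux_dich {m n : ℕ} (A : Matrix (Fin m) (Fin n) ℝ) (C : ℝ) (hA : ∑ i, ∑ j, A i j ^ 2 ≤ C ^ 2) :
    specNorm ((Aᵀ * A)⁻¹) = 0 ∨ (0 < n ∧ 1 ≤ (n * C ^ 2) * specNorm ((Aᵀ * A)⁻¹)) := by
  rcases Nat.eq_zero_or_pos n with rfl | hn
  · left
    rw [Subsingleton.elim ((Aᵀ * A)⁻¹) 0, specNorm, map_zero, norm_zero]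
  by_cases hdet : IsUnit (Aᵀ * A).det
  swap
  · left
    rw [Matrix.nonsing_inv_apply_not_isUnit _ hdet, specNorm, map_zero, norm_zero]
  right
  refine ⟨hn, ?_⟩
  have : Nonempty (Fin n) := ⟨⟨0, hn⟩⟩
  have h1 : (1:ℝ) ≤ specNorm (Aᵀ * A) * specNorm ((Aᵀ * A)⁻¹) := by
    have h2 := norm_mul_le (Matrix.toEuclideanCLM (𝕜 := ℝ) (Aᵀ * A)) (Matrix.toEuclideanCLM (𝕜 := ℝ) (Aᵀ * A)⁻¹)
    rw [← map_mul, Matrix.mul_nonsing_inv _ hdet, map_one, norm_one] at h2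
    exact h2
  refine h1.trans (mul_le_mul_of_nonneg_right ((aux_spec_le A).trans ?_) (norm_nonneg _))
  rw [Finset.sum_comm]
  gcongr

lemma aux_trace {m n : ℕ} (A : Matrix (Fin m) (Fin n) ℝ) :
    specNorm ((Aᵀ * A)⁻¹) ≤ n * ∑ j, (Aᵀ * A)⁻¹ j j := by
  by_cases hdet : IsUnit (Aᵀ * A).det
  · conv_lhs => rw [aux_alg A hdet]
    refine (aux_spec_le _).trans (le_of_eq ?_)
    congr 1
    exact Finset.sum_congr rfl fun j _ => (aux_jj A j hdet).symm
  · rw [Matrix.nonsing_inv_apply_not_isUnit _ hdet, specNorm, map_zero, norm_zero]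
    simp

lemma aux_pow {m n : ℕ} (A : Matrix (Fin m) (Fin (n+1)) ℝ) (p : ℝ) (hp : 0 < p) :
    ENNReal.ofReal (specNorm ((Aᵀ * A)⁻¹) ^ p) ≤
      ∑ j, ENNReal.ofReal (((n+1 : ℕ):ℝ) * (n+1 : ℕ)) ^ p * ENNReal.ofReal ((Aᵀ * A)⁻¹ j j) ^ p := by
  obtain ⟨j, -, hj⟩ := Finset.exists_max_image Finset.univ (fun j => (Aᵀ * A)⁻¹ j j) ⟨0, Finset.mem_univ _⟩
  have h1 : ∑ i, (Aᵀ * A)⁻¹ i i ≤ (n+1 : ℕ) * (Aᵀ * A)⁻¹ j j := by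
    refine (Finset.sum_le_sum fun i hi => hj i hi).trans (le_of_eq ?_)
    simp
  have h2 : specNorm ((Aᵀ * A)⁻¹) ≤ (((n+1 : ℕ):ℝ) * (n+1 : ℕ)) * (Aᵀ * A)⁻¹ j j := by
    refine (aux_trace A).trans ?_
    rw [mul_assoc]
    gcongr
  rw [← ENNReal.ofReal_rpow_of_nonneg (show 0 ≤ specNorm ((Aᵀ * A)⁻¹) from norm_nonneg _) hp.le]
  refine le_trans ?_ (Finset.single_le_sum (f := fun j => ENNReal.ofReal (((n+1 : ℕ):ℝ) * (n+1 : ℕ)) ^ p * ENNReal.ofReal ((Aᵀ * A)⁻¹ j j) ^ p)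
    (fun _ _ => bot_le) (Finset.mem_univ j))
  rw [← ENNReal.mul_rpow_of_nonneg _ _ hp.le, ← ENNReal.ofReal_mul (by positivity)]
  exact ENNReal.rpow_le_rpow (ENNReal.ofReal_le_ofReal h2) hp.le

/-- Lemma 5.6: if a random matrix `A ∈ ℝ^{m×n}` with `m ≥ n` is almost
surely bounded in Frobenius norm and has a bounded probability density function, then
`(AᵀA)⁻¹` has a finite `p`-th moment (`E[‖(AᵀA)⁻¹‖₂^p] < ∞`) for every `p < (m−n+1)/2`. -/
theorem stmt9 {Ω : Type*} [MeasurableSpace Ω] (μ : Measure Ω) [IsProbabilityMeasure μ]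
    {m n : ℕ} (hmn : n ≤ m)
    (A : Ω → Matrix (Fin m) (Fin n) ℝ) (hA_meas : Measurable A)
    (C : ℝ) (hbdd : μ {ω | C < frobNorm (A ω)} = 0)
    (pdf : Matrix (Fin m) (Fin n) ℝ → ENNReal)
    (hpdf : Measure.map A μ = MeasureTheory.volume.withDensity pdf)
    (Cd : ENNReal) (hCd : Cd ≠ ⊤) (hpdf_bdd : ∀ B, pdf B ≤ Cd) :
    ∀ p : ℝ, p < ((m : ℝ) - n + 1) / 2 →
      Integrable (fun ω => specNorm (((A ω)ᵀ * A ω)⁻¹) ^ p) μ := by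
  intro p hp
  have hA' : Measurable (fun ω => (fun i j => A ω i j : Fin m → Fin n → ℝ)) := hA_meas
  have hmeas : Measurable (fun ω => specNorm (((A ω)ᵀ * A ω)⁻¹) ^ p) := by
    have h1 : Measurable (fun ω => (fun i j => ((A ω)ᵀ * A ω)⁻¹ i j : Fin n → Fin n → ℝ)) :=
      measurable_pi_iff.2 fun i => measurable_pi_iff.2 fun j => (aux_meas i j).comp hA'
    exact (aux_spec_meas.comp h1).pow_const p
  have hae : ∀ᵐ ω ∂μ, ∑ i, ∑ j, A ω i j ^ 2 ≤ C ^ 2 := by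
    filter_upwards [measure_eq_zero_iff_ae_notMem.1 hbdd] with ω hω
    have h1 : frobNorm (A ω) ≤ C := not_lt.1 hω
    exact (Real.sqrt_le_iff.1 h1).2
  by_cases hcase : p ≤ 0 ∨ n = 0
  · refine Integrable.of_bound hmeas.aestronglyMeasurable (1 + ((n * C ^ 2)⁻¹) ^ p) ?_
    filter_upwards [hae] with ω hω
    have hK : 0 ≤ (n * C ^ 2 : ℝ) := by positivity
    have hx : 0 ≤ specNorm (((A ω)ᵀ * A ω)⁻¹) := norm_nonneg _
    rw [Real.norm_of_nonneg (Real.rpow_nonneg hx p)]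
    rcases aux_dich (A ω) C hω with h | ⟨hn, h⟩
    · rw [h]
      have h3 : 0 ≤ ((n * C ^ 2 : ℝ)⁻¹) ^ p := by positivity
      linarith [Real.zero_rpow_le_one p]
    · have hp0 : p ≤ 0 := by
        rcases hcase with h | h
        · exact h
        · omega
      have hK' : 0 < (n * C ^ 2 : ℝ) := by
        rcases hK.eq_or_lt with h' | h'
        · rw [← h'] at h; norm_num at h
        · exact h'
      have h4 : (n * C ^ 2 : ℝ)⁻¹ ≤ specNorm (((A ω)ᵀ * A ω)⁻¹) := (inv_le_iff_one_le_mul₀' hK').2 h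
      linarith [Real.rpow_le_rpow_of_nonpos (inv_pos.2 hK') h4 hp0]
  push Not at hcase
  obtain ⟨hp0, hn0⟩ := hcase
  obtain ⟨n, rfl⟩ := Nat.exists_eq_succ_of_ne_zero hn0
  have hnm : n < m := hmn
  have hp2 : 2 * p < (m - n : ℕ) := by
    rw [Nat.cast_sub hnm.le]
    push_cast at hp
    linarith
  refine ⟨hmeas.aestronglyMeasurable, ?_⟩
  rw [hasFiniteIntegral_iff_ofReal (by
    filter_upwards with ω
    exact Real.rpow_nonneg (norm_nonneg _) p)]
  refine lt_of_le_of_lt (lintegral_mono fun ω => aux_pow (A ω) p hp0) ?_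
  have hmj : ∀ j, Measurable (fun ω => ENNReal.ofReal (((A ω)ᵀ * A ω)⁻¹ j j) ^ p) := fun j =>
    ((aux_meas j j).comp hA').ennreal_ofReal.pow_const p
  rw [lintegral_finsetSum _ (fun j _ => (hmj j).const_mul _)]
  refine ENNReal.sum_lt_top.2 fun j _ => ?_
  rw [lintegral_const_mul _ (hmj j)]
  refine ENNReal.mul_lt_top (ENNReal.rpow_lt_top_of_nonneg hp0.le ENNReal.ofReal_ne_top) ?_
  have hS : MeasurableSet ({A : Fin m → Fin (n+1) → ℝ | ∀ i, ∑ k, A k i ^ 2 ≤ C ^ 2}) := by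
    simp only [Set.ofPred_forall]
    refine MeasurableSet.iInter fun i => measurableSet_le ?_ measurable_const
    fun_prop
  have hG : Measurable (({A : Fin m → Fin (n+1) → ℝ | ∀ i, ∑ k, A k i ^ 2 ≤ C ^ 2}).indicator
      (fun A => ENNReal.ofReal (((Matrix.of A)ᵀ * Matrix.of A)⁻¹ j j) ^ p)) :=
    ((aux_meas j j).ennreal_ofReal.pow_const p).indicator hS
  have hmain := aux_main hnm p hp0 hp2 C j
  set G := (({A : Fin m → Fin (n+1) → ℝ | ∀ i, ∑ k, A k i ^ 2 ≤ C ^ 2}).indicator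
      (fun A => ENNReal.ofReal (((Matrix.of A)ᵀ * Matrix.of A)⁻¹ j j) ^ p)) with hGdef
  have h5 : ∫⁻ ω, ENNReal.ofReal (((A ω)ᵀ * A ω)⁻¹ j j) ^ p ∂μ = ∫⁻ ω, G (A ω) ∂μ := by
    refine lintegral_congr_ae ?_
    filter_upwards [hae] with ω hω
    have hmem : (A ω : Fin m → Fin (n+1) → ℝ) ∈ ({A : Fin m → Fin (n+1) → ℝ | ∀ i, ∑ k, A k i ^ 2 ≤ C ^ 2}) := by
      intro i
      rw [Finset.sum_comm] at hω
      exact (Finset.single_le_sum (f := fun i => ∑ k, A ω k i ^ 2) (fun i _ => by positivity) (Finset.mem_univ i)).trans hω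
    rw [hGdef]
    exact (Set.indicator_of_mem hmem (fun A : Fin m → Fin (n+1) → ℝ =>
      ENNReal.ofReal (((Matrix.of A)ᵀ * Matrix.of A)⁻¹ j j) ^ p)).symm
  have h6 : ∫⁻ ω, G (A ω) ∂μ = ∫⁻ B, G B ∂(Measure.map A μ) := (lintegral_map hG hA_meas).symm
  have h7 : Measure.map A μ ≤ Cd • (volume : Measure (Matrix (Fin m) (Fin (n+1)) ℝ)) := by
    rw [hpdf, ← withDensity_const]
    exact withDensity_mono (Filter.Eventually.of_forall hpdf_bdd)
  rw [h5, h6]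
  refine lt_of_le_of_lt (lintegral_mono' h7 le_rfl) ?_
  refine lt_of_eq_of_lt (lintegral_smul_measure Cd _) ?_
  exact ENNReal.mul_lt_top hCd.lt_top hmain
end

section
/- (Finite moments of regularized Gauss-Newton estimators.) Let Ĵ₁, …, Ĵ_N ∈ ℝ^{m×n} be random matrices whose stacked matrix A = (1/√N) [Ĵ₁; …; Ĵ_N] ∈ ℝ^{Nm×n} satisfies Nm ≥ n, P[‖A‖_F > C] = 0 for some constant C, and has a bounded probability density function on ℝ^{Nm×n}. Let R = (1/N) Σ_{i=1}^N Ĵᵢᵀ Ĵᵢ. Then R⁻¹ has a finite p-th moment (E[‖R⁻¹‖₂^p] < ∞) for every p < (mN − n + 1)/2. Moreover, for any deterministic sequence of coefficients and any a, b > 0, the matrix B⁻¹ = (a GᵀG + b R)⁻¹ with G = Σ_{i=1}^N aᵢ Ĵᵢ (aᵢ ∈ ℝ) also has a finite p-th moment whenever N > (2p + n − 1)/m. -/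
open MeasureTheory Matrix

theorem vol_slab {ι : Type*} [Fintype ι] (W : Submodule ℝ (EuclideanSpace ℝ ι)) (d : ℕ)
    (hd : Module.finrank ℝ W ≤ d) (hdc : d ≤ Fintype.card ι) (C t : ℝ) (hC : 0 ≤ C) (ht : 0 ≤ t) :
    volume {e : EuclideanSpace ℝ ι | ‖e‖ ≤ C ∧ ∃ w ∈ W, ‖e - w‖ ≤ t}
      ≤ ENNReal.ofReal ((2 * C) ^ d * (2 * t) ^ (Fintype.card ι - d)) := by
  classical
  have h1 := Submodule.finrank_add_finrank_orthogonal W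
  rw [finrank_euclideanSpace] at h1
  have h2 : Fintype.card ι - d ≤ Module.finrank ℝ Wᗮ := by omega
  obtain ⟨s, -, hs⟩ := Finset.exists_subset_card_eq
    (s := (Finset.univ : Finset ι)) (n := Fintype.card ι - d) (by simp)
  let u := stdOrthonormalBasis ℝ Wᗮ
  let g : s → Fin (Module.finrank ℝ Wᗮ) := fun i => Fin.castLE (by omega) (s.equivFin i)
  have hg : Function.Injective g := by
    intro a b h
    simpa [g] using h
  let v : ι → EuclideanSpace ℝ ι := fun i => if h : i ∈ s then (u (g ⟨i, h⟩) : EuclideanSpace ℝ ι) else 0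
  have hvs : ∀ i : s, v i = (u (g i) : EuclideanSpace ℝ ι) := by
    intro i; simp [v]
  have hv : Orthonormal ℝ ((s : Set ι).domRestrict v) := by
    have h3 : Orthonormal ℝ (fun i : s => (u (g i) : EuclideanSpace ℝ ι)) := by
      have := (u.orthonormal.comp g hg)
      exact this.comp_linearIsometry (Wᗮ).subtypeₗᵢ
    have h4 : (s : Set ι).domRestrict v = fun i : s => (u (g i) : EuclideanSpace ℝ ι) := funext hvs
    rw [h4]
    exact h3
  obtain ⟨b, hb⟩ := hv.exists_orthonormalBasis_extension_of_card_eq (by simp)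
  let r : ι → ℝ := fun i => if i ∈ s then t else C
  have hsub : {e : EuclideanSpace ℝ ι | ‖e‖ ≤ C ∧ ∃ w ∈ W, ‖e - w‖ ≤ t} ⊆
      b.repr ⁻¹' ((MeasurableEquiv.toLp 2 (ι → ℝ)).symm ⁻¹' (Set.Icc (-r) r)) := by
    rintro e ⟨he, w, hw, hew⟩
    have key : ∀ i, |b.repr e i| ≤ r i := by
      intro i
      rw [b.repr_apply_apply]
      by_cases hi : i ∈ s
      · simp only [r, hi, if_true]
        have h5 : b i ∈ Wᗮ := by
          rw [hb i hi, show v i = _ from hvs ⟨i, hi⟩]; exact Submodule.coe_mem _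
        have h6 : inner ℝ (b i) e = inner ℝ (b i) (e - w) := by
          rw [inner_sub_right, Submodule.inner_left_of_mem_orthogonal hw h5, sub_zero]
        rw [h6]
        refine (abs_real_inner_le_norm _ _).trans ?_
        simpa using hew
      · simp only [r, hi, if_false]
        refine (abs_real_inner_le_norm _ _).trans ?_
        simpa using he
    refine ⟨fun i => ?_, fun i => ?_⟩
    · exact (abs_le.1 (key i)).1
    · exact (abs_le.1 (key i)).2
  refine (measure_mono hsub).trans ?_
  rw [b.measurePreserving_repr.measure_preimage (by measurability),
    (EuclideanSpace.volume_preserving_symm_measurableEquiv_toLp ι).measure_preimage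
      measurableSet_Icc.nullMeasurableSet, Real.volume_Icc_pi]
  rw [← ENNReal.ofReal_prod_of_nonneg]
  · apply ENNReal.ofReal_le_ofReal
    have : ∀ i, r i - (-r) i = if i ∈ s then 2 * t else 2 * C := by
      intro i; simp only [Pi.neg_apply, r]; split_ifs <;> ring
    simp only [this]
    rw [Finset.prod_ite]
    simp only [Finset.prod_const]
    have e1 : (Finset.univ.filter (fun i => i ∈ s)).card = Fintype.card ι - d := by
      rw [← hs]; congr 1; ext; simp
    have e2 : (Finset.univ.filter (fun i => ¬ i ∈ s)).card = d := by
      have := Finset.card_filter_add_card_filter_not (s := (Finset.univ : Finset ι)) (fun i => i ∈ s)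
      rw [Finset.card_univ] at this
      omega
    rw [e1, e2, mul_comm]
  · intro i _
    simp only [Pi.neg_apply, r]; split_ifs <;> linarith

/-- Bounded matrices with an almost-kernel vector whose `j`-th entry is dominant. -/
def badSet (κ : Type*) [Fintype κ] {n : ℕ} (j : Fin n) (C t : ℝ) : Set (κ → Fin n → ℝ) :=
  {A | (∀ k i, |A k i| ≤ C) ∧ ∃ x : Fin n → ℝ, (∀ i, |x i| ≤ 1) ∧ x j = 1 ∧
    ∑ k, (∑ i, A k i * x i) ^ 2 ≤ t ^ 2}

theorem badSet_compact (κ : Type*) [Fintype κ] {n : ℕ} (j : Fin n) (C t : ℝ) :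
    IsCompact (badSet κ j C t) := by
  have h1 : IsCompact ((Set.Icc (fun _ _ => -C) (fun _ _ => C) : Set (κ → Fin n → ℝ)) ×ˢ
      (Set.Icc (fun _ => -1) (fun _ => 1) : Set (Fin n → ℝ))) :=
    isCompact_Icc.prod isCompact_Icc
  have h2 : IsClosed {z : (κ → Fin n → ℝ) × (Fin n → ℝ) | z.2 j = 1 ∧
      ∑ k, (∑ i, z.1 k i * z.2 i) ^ 2 ≤ t ^ 2} := by
    apply IsClosed.inter
    · have c1 : Continuous fun z : (κ → Fin n → ℝ) × (Fin n → ℝ) => z.2 j := by fun_prop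
      exact isClosed_eq c1 continuous_const
    · have c2 : Continuous fun z : (κ → Fin n → ℝ) × (Fin n → ℝ) =>
          ∑ k, (∑ i, z.1 k i * z.2 i) ^ 2 := by fun_prop
      exact isClosed_le c2 continuous_const
  have h3 := (h1.inter_right h2).image continuous_fst
  convert h3 using 1
  ext A
  constructor
  · rintro ⟨hA, x, hx, hxj, hs⟩
    refine ⟨(A, x), ⟨⟨⟨fun k i => (abs_le.1 (hA k i)).1, fun k i => (abs_le.1 (hA k i)).2⟩,
      ⟨fun i => (abs_le.1 (hx i)).1, fun i => (abs_le.1 (hx i)).2⟩⟩, hxj, hs⟩, rfl⟩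
  · rintro ⟨⟨A', x⟩, ⟨⟨⟨ha, hb⟩, ⟨hc, hd⟩⟩, hxj, hs⟩, rfl⟩
    exact ⟨fun k i => abs_le.2 ⟨ha k i, hb k i⟩, x, fun i => abs_le.2 ⟨hc i, hd i⟩, hxj, hs⟩

/-- The matrix with column `j` equal to `e` and other columns zero. -/
def colLift {κ : Type*} {n : ℕ} (j : Fin n) (e : EuclideanSpace ℝ κ) : κ → Fin n → ℝ :=
  fun k i => if i = j then e k else 0

theorem slice_bound (κ : Type*) [Fintype κ] {n : ℕ} (hn : n ≤ Fintype.card κ) (j : Fin n)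
    (C t : ℝ) (hC : 0 ≤ C) (ht : 0 ≤ t) (A : κ → Fin n → ℝ) :
    volume {e : EuclideanSpace ℝ κ | A + colLift j e ∈ badSet κ j C t} ≤
      ENNReal.ofReal ((2 * (Real.sqrt (Fintype.card κ * C ^ 2))) ^ (n - 1) *
        (2 * t) ^ (Fintype.card κ - (n - 1))) := by
  classical
  let col : Fin n → EuclideanSpace ℝ κ := fun i => WithLp.toLp 2 (fun k => A k i)
  let W : Submodule ℝ (EuclideanSpace ℝ κ) :=
    Submodule.span ℝ (((Finset.univ.erase j).image col : Finset _) : Set (EuclideanSpace ℝ κ))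
  have hW : Module.finrank ℝ W ≤ n - 1 := by
    refine (finrank_span_finset_le_card _).trans (Finset.card_image_le.trans ?_)
    simp
  have h1 := vol_slab W (n - 1) hW (by omega) (Real.sqrt (Fintype.card κ * C ^ 2)) t
    (Real.sqrt_nonneg _) ht
  refine le_trans ?_ h1
  rw [← measure_preimage_add volume (col j)
    {e | ‖e‖ ≤ √(↑(Fintype.card κ) * C ^ 2) ∧ ∃ w ∈ W, ‖e - w‖ ≤ t}]
  apply measure_mono
  rintro e ⟨hA, x, hx, hxj, hs⟩
  refine ⟨?_, -∑ i ∈ Finset.univ.erase j, x i • col i, ?_, ?_⟩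
  · rw [EuclideanSpace.norm_eq]
    apply Real.sqrt_le_sqrt
    have : ∀ k ∈ (Finset.univ : Finset κ), ‖(col j + e) k‖ ^ 2 ≤ C ^ 2 := by
      intro k _
      have := hA k j
      simp only [Pi.add_apply, colLift, if_true] at this
      simp only [col, PiLp.add_apply, Real.norm_eq_abs]
      gcongr
    simpa using Finset.sum_le_sum this
  · apply Submodule.neg_mem
    apply Submodule.sum_mem
    intro i hi
    apply Submodule.smul_mem
    apply Submodule.subset_span
    simp only [Finset.coe_image]
    exact ⟨i, hi, rfl⟩
  · rw [EuclideanSpace.norm_eq, Real.sqrt_le_left ht]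
    refine le_of_eq_of_le ?_ hs
    apply Finset.sum_congr rfl
    intro k _
    rw [Real.norm_eq_abs, sq_abs]
    congr 1
    rw [← Finset.add_sum_erase _ _ (Finset.mem_univ j)]
    have : ∑ i ∈ Finset.univ.erase j, (A + colLift j e) k i * x i =
        ∑ i ∈ Finset.univ.erase j, x i * A k i := by
      apply Finset.sum_congr rfl
      intro i hi
      have := Finset.ne_of_mem_erase hi
      simp [colLift, this, mul_comm]
    rw [this]
    simp [col, colLift, hxj]
    ring

theorem badSet_volume (κ : Type*) [Fintype κ] {n : ℕ} (hn : n ≤ Fintype.card κ) (j : Fin n)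
    (C : ℝ) (hC : 0 ≤ C) : ∃ M : ℝ, 0 ≤ M ∧ ∀ t : ℝ, 0 ≤ t →
    volume (badSet κ j C t) ≤ ENNReal.ofReal (M * t ^ (Fintype.card κ - (n - 1))) := by
  set q := Fintype.card κ - (n - 1) with hq
  set D := 2 * Real.sqrt (Fintype.card κ * C ^ 2) with hD
  have hD0 : 0 ≤ D := by positivity
  let box : Set (κ → Fin n → ℝ) := Set.Icc (fun _ _ => -(C + 1)) (fun _ _ => C + 1)
  let Q : Set (EuclideanSpace ℝ κ) := Metric.closedBall 0 1
  have hQ0 : volume Q ≠ 0 := (Metric.measure_closedBall_pos volume 0 one_pos).ne'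
  have hQt : volume Q ≠ ⊤ := (isCompact_closedBall _ _).measure_lt_top.ne
  have hbox : volume box ≠ ⊤ := (isCompact_Icc).measure_lt_top.ne
  have hcl : Continuous (colLift (κ := κ) j) := by
    unfold colLift
    refine continuous_pi fun k => continuous_pi fun i => ?_
    split_ifs <;> fun_prop
  refine ⟨D ^ (n - 1) * 2 ^ q * (volume box).toReal / (volume Q).toReal, by positivity, ?_⟩
  intro t ht
  have hS : MeasurableSet (badSet κ j C t) := (badSet_compact κ j C t).measurableSet
  set L := ENNReal.ofReal (D ^ (n - 1) * (2 * t) ^ q) with hL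
  have key : volume (badSet κ j C t) * volume Q ≤ L * volume box := by
    calc volume (badSet κ j C t) * volume Q
        = ∫⁻ e in Q, ∫⁻ A, (badSet κ j C t).indicator 1 (A + colLift j e) := by
          rw [← setLIntegral_const]
          congr 1
          funext e
          rw [lintegral_add_right_eq_self (μ := volume) ((badSet κ j C t).indicator 1) (colLift j e),
            lintegral_indicator_one hS]
      _ = ∫⁻ A, ∫⁻ e in Q, (badSet κ j C t).indicator 1 (A + colLift j e) := by
          rw [lintegral_lintegral_swap]
          apply Measurable.aemeasurable
          have : Measurable (fun z : EuclideanSpace ℝ κ × (κ → Fin n → ℝ) => z.2 + colLift j z.1) := by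
            exact (continuous_snd.add (hcl.comp continuous_fst)).measurable
          exact (measurable_one.indicator hS).comp this
      _ ≤ ∫⁻ A, box.indicator (fun _ => L) A := by
          apply lintegral_mono
          intro A
          by_cases hA : A ∈ box
          · rw [Set.indicator_of_mem hA]
            refine (setLIntegral_le_lintegral _ _).trans ?_
            refine le_trans (le_of_eq ?_) (slice_bound κ hn j C t hC ht A)
            rw [← lintegral_indicator_one]
            · rfl
            · have : Measurable (fun e : EuclideanSpace ℝ κ => A + colLift j e) :=
                (continuous_const.add hcl).measurable
              exact this hS
          · rw [Set.indicator_of_notMem hA]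
            apply le_of_eq
            rw [setLIntegral_eq_zero_iff' measurableSet_closedBall]
            · refine Filter.Eventually.of_forall fun e he => ?_
              apply Set.indicator_of_notMem
              intro hmem
              apply hA
              have h1 : ∀ k i, |A k i| ≤ C + 1 := by
                intro k i
                have h2 := hmem.1 k i
                have h3 : |colLift j e k i| ≤ 1 := by
                  simp only [colLift]
                  split_ifs
                  · have h4 : ‖e‖ ≤ 1 := by simpa [Q] using he
                    exact (PiLp.norm_apply_le e k).trans h4
                  · simp
                have h5 : A k i = (A + colLift j e) k i - colLift j e k i := by simp
                rw [h5]
                exact (abs_sub _ _).trans (add_le_add h2 h3)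
              exact ⟨fun k i => (abs_le.1 (h1 k i)).1, fun k i => (abs_le.1 (h1 k i)).2⟩
            · apply Measurable.aemeasurable
              have : Measurable (fun e : EuclideanSpace ℝ κ => A + colLift j e) :=
                (continuous_const.add hcl).measurable
              exact (measurable_one.indicator hS).comp this
      _ = L * volume box := by
          rw [lintegral_indicator measurableSet_Icc, setLIntegral_const]
  have h6 : volume (badSet κ j C t) ≤ L * volume box / volume Q :=
    (ENNReal.le_div_iff_mul_le (Or.inl hQ0) (Or.inl hQt)).2 key
  refine h6.trans (le_of_eq ?_)
  have hQp : 0 < (volume Q).toReal := ENNReal.toReal_pos hQ0 hQt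
  rw [← ENNReal.ofReal_toReal hbox, ← ENNReal.ofReal_toReal hQt, hL,
    ← ENNReal.ofReal_mul (by positivity), ← ENNReal.ofReal_div_of_pos hQp]
  simp only [ENNReal.toReal_ofReal ENNReal.toReal_nonneg]
  congr 1
  rw [mul_pow]
  ring

theorem integrable_of_tail {Ω : Type*} [MeasurableSpace Ω] (μ : Measure Ω) [IsProbabilityMeasure μ]
    (f : Ω → ℝ) (hf : Measurable f) (hf0 : ∀ ω, 0 ≤ f ω) (M r p : ℝ) (hM : 0 ≤ M) (hp : 0 < p)
    (hpr : p < r)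
    (tail : ∀ s : ℝ, 0 < s → μ {ω | s < f ω} ≤ ENNReal.ofReal (M * s ^ (-r))) :
    Integrable (fun ω => f ω ^ p) μ := by
  refine ⟨(hf.pow_const p).aestronglyMeasurable, ?_⟩
  rw [hasFiniteIntegral_iff_ofReal (Filter.Eventually.of_forall fun ω => Real.rpow_nonneg (hf0 ω) p)]
  rw [lintegral_rpow_eq_lintegral_meas_lt_mul μ (Filter.Eventually.of_forall hf0) hf.aemeasurable hp]
  apply ENNReal.mul_lt_top ENNReal.ofReal_lt_top
  rw [← Set.Ioc_union_Ioi_eq_Ioi (zero_le_one' ℝ)]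
  refine (lintegral_union_le _ _ _).trans_lt ?_
  apply ENNReal.add_lt_top.2
  constructor
  · have h1 : IntegrableOn (fun t : ℝ => t ^ (p - 1)) (Set.Ioc 0 1) := by
      have := intervalIntegral.intervalIntegrable_rpow' (a := 0) (b := 1) (r := p - 1) (by linarith)
      rwa [intervalIntegrable_iff_integrableOn_Ioc_of_le zero_le_one] at this
    refine lt_of_le_of_lt (lintegral_mono fun t => ?_) h1.lintegral_lt_top
    exact (mul_le_mul_left prob_le_one _).trans (by rw [one_mul])
  · have h1 : IntegrableOn (fun t : ℝ => M * t ^ (p - 1 - r)) (Set.Ioi 1) :=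
      (integrableOn_Ioi_rpow_of_lt (by linarith) one_pos).const_mul M
    refine lt_of_le_of_lt (setLIntegral_mono' measurableSet_Ioi fun t ht => ?_) h1.lintegral_lt_top
    have ht0 : (0:ℝ) < t := lt_trans one_pos ht
    refine (mul_le_mul_left (tail t ht0) _).trans ?_
    rw [← ENNReal.ofReal_mul (by positivity), mul_assoc, ← Real.rpow_add ht0]
    apply le_of_eq
    congr 3
    ring

theorem specNorm_nonneg {n : ℕ} (M : Matrix (Fin n) (Fin n) ℝ) : 0 ≤ specNorm M := norm_nonneg _

theorem specNorm_continuous {n : ℕ} :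
    Continuous (fun M : Matrix (Fin n) (Fin n) ℝ => specNorm M) := by
  have : Continuous (fun M : Matrix (Fin n) (Fin n) ℝ => Matrix.toEuclideanCLM (𝕜 := ℝ) M) :=
    LinearMap.continuous_of_finiteDimensional
      (Matrix.toEuclideanCLM (𝕜 := ℝ) (n := Fin n)).toAlgEquiv.toLinearMap
  exact this.norm

theorem mem_badSet_of_lt {κ : Type*} [Fintype κ] {n : ℕ} (A : κ → Fin n → ℝ)
    (M : Matrix (Fin n) (Fin n) ℝ) (β s C : ℝ) (hβ : 0 < β) (hs : 0 < s)
    (hB : ∀ x : Fin n → ℝ, β * ∑ k, (∑ i, A k i * x i) ^ 2 ≤ x ⬝ᵥ M *ᵥ x)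
    (hA : ∀ k i, |A k i| ≤ C) (hM : s < specNorm M⁻¹) :
    ∃ j, A ∈ badSet κ j C (Real.sqrt (n / (β * s))) := by
  have hdet : IsUnit M.det := by
    by_contra h
    rw [Matrix.nonsing_inv_apply_not_isUnit M h] at hM
    simp [specNorm] at hM
    linarith
  obtain ⟨y, hy⟩ : ∃ y, s * ‖y‖ < ‖Matrix.toEuclideanCLM (𝕜 := ℝ) M⁻¹ y‖ := by
    by_contra! h
    exact absurd (ContinuousLinearMap.opNorm_le_bound _ hs.le h) (not_le.2 hM)
  set x := Matrix.toEuclideanCLM (𝕜 := ℝ) M⁻¹ y with hx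
  have hx0 : 0 < ‖x‖ := lt_of_le_of_lt (by positivity) hy
  have hMx : M *ᵥ x.ofLp = y.ofLp := by
    rw [hx, Matrix.ofLp_toEuclideanCLM, Matrix.mulVec_mulVec, Matrix.mul_nonsing_inv M hdet,
      Matrix.one_mulVec]
  have h1 := hB x.ofLp
  rw [hMx] at h1
  have h2 : x.ofLp ⬝ᵥ y.ofLp ≤ ‖x‖ * ‖y‖ := by
    refine le_trans (le_of_eq ?_) (real_inner_le_norm x y)
    rw [EuclideanSpace.inner_eq_star_dotProduct, dotProduct_comm]
    simp
  have hsq : ‖x‖ ^ 2 = ∑ i, x.ofLp i ^ 2 := EuclideanSpace.real_norm_sq_eq x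
  have hne : Nonempty (Fin n) := by
    by_contra h
    rw [not_nonempty_iff] at h
    have : x = 0 := Subsingleton.elim _ _
    simp [this] at hx0
  obtain ⟨j, hj⟩ := Finite.exists_max (fun i => |x.ofLp i|)
  have hxj : ‖x‖ ^ 2 ≤ n * x.ofLp j ^ 2 := by
    rw [hsq]
    have : ∀ i ∈ (Finset.univ : Finset (Fin n)), x.ofLp i ^ 2 ≤ x.ofLp j ^ 2 :=
      fun i _ => sq_le_sq.2 (hj i)
    simpa using Finset.sum_le_sum this
  have hxj0 : x.ofLp j ≠ 0 := by
    intro h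
    rw [h] at hxj
    nlinarith
  have hpos : 0 < x.ofLp j ^ 2 := by positivity
  refine ⟨j, hA, fun i => x.ofLp i / x.ofLp j, ?_, div_self hxj0, ?_⟩
  · intro i
    rw [abs_div]
    exact div_le_one_of_le₀ (hj i) (abs_nonneg _)
  · rw [Real.sq_sqrt (by positivity)]
    have h3 : ∑ k, (∑ i, A k i * (x.ofLp i / x.ofLp j)) ^ 2 =
        (∑ k, (∑ i, A k i * x.ofLp i) ^ 2) / x.ofLp j ^ 2 := by
      rw [Finset.sum_div]
      apply Finset.sum_congr rfl
      intro k _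
      rw [← div_pow, Finset.sum_div]
      congr 1
      apply Finset.sum_congr rfl
      intro i _
      ring
    rw [h3, div_le_div_iff₀ hpos (by positivity)]
    have h4 : s * (β * ∑ k, (∑ i, A k i * x.ofLp i) ^ 2) ≤ s * (‖x‖ * ‖y‖) := by
      exact mul_le_mul_of_nonneg_left (h1.trans h2) hs.le
    nlinarith [mul_le_mul_of_nonneg_left hy.le hx0.le]

theorem core {Ω : Type*} [MeasurableSpace Ω] (μ : Measure Ω) [IsProbabilityMeasure μ]
    {κ : Type*} [Fintype κ] {n : ℕ} (hn0 : 0 < n) (hn : n ≤ Fintype.card κ)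
    (A : Ω → κ → Fin n → ℝ) (hA : Measurable A) (C : ℝ) (hC : 0 ≤ C)
    (hAC : ∀ᵐ ω ∂μ, ∀ k i, |A ω k i| ≤ C) (Cd : ENNReal) (hCd : Cd ≠ ⊤)
    (hdens : ∀ S : Set (κ → Fin n → ℝ), MeasurableSet S → μ (A ⁻¹' S) ≤ Cd * volume S)
    (Bf : (κ → Fin n → ℝ) → Matrix (Fin n) (Fin n) ℝ) (hBf : Continuous Bf)
    (β : ℝ) (hβ : 0 < β)
    (hB : ∀ A, ∀ x : Fin n → ℝ, β * ∑ k, (∑ i, A k i * x i) ^ 2 ≤ x ⬝ᵥ Bf A *ᵥ x)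
    (p : ℝ) (hp : 2 * p < Fintype.card κ - n + 1) :
    Integrable (fun ω => specNorm ((Bf (A ω))⁻¹) ^ p) μ := by
  have hmeas : Measurable (fun ω => specNorm ((Bf (A ω))⁻¹)) := by
    have h1 : (fun ω => specNorm ((Bf (A ω))⁻¹)) =
        fun ω => |((Bf (A ω)).det)⁻¹| * specNorm (Bf (A ω)).adjugate := by
      funext ω
      rw [Matrix.inv_def, Ring.inverse_eq_inv']
      simp [specNorm, norm_smul]
    rw [h1]
    have m1 : Measurable (fun a => (Bf a).det) := (hBf.matrix_det).measurable
    have m2 : Measurable (fun a => specNorm (Bf a).adjugate) :=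
      (specNorm_continuous.comp hBf.matrix_adjugate).measurable
    exact ((m1.comp hA).inv.abs).mul (m2.comp hA)
  rcases le_or_gt p 0 with hp0 | hp0
  · obtain ⟨D, hD⟩ : ∃ D, ∀ a ∈ (Set.Icc (fun _ _ => -C) (fun _ _ => C) : Set (κ → Fin n → ℝ)),
        specNorm (Bf a) ≤ D := by
      obtain ⟨D, hD⟩ := isCompact_Icc.bddAbove_image
        (f := fun a : κ → Fin n → ℝ => specNorm (Bf a))
        (K := Set.Icc (fun _ _ => -C) (fun _ _ => C))
        (specNorm_continuous.comp hBf).continuousOn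
      exact ⟨D, fun a ha => hD ⟨a, ha, rfl⟩⟩
    refine Integrable.of_bound (hmeas.pow_const p).aestronglyMeasurable (1 + (|D| + 1) ^ (-p)) ?_
    filter_upwards [hAC] with ω hω
    have hD' := hD (A ω) ⟨fun k i => (abs_le.1 (hω k i)).1, fun k i => (abs_le.1 (hω k i)).2⟩
    set f := specNorm ((Bf (A ω))⁻¹) with hf
    have hf0 : 0 ≤ f := specNorm_nonneg _
    rw [Real.norm_of_nonneg (Real.rpow_nonneg hf0 p)]
    have hE : (0:ℝ) ≤ (|D| + 1) ^ (-p) := by positivity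
    rcases hf0.eq_or_lt with h | h
    · rw [← h]
      rcases hp0.eq_or_lt with h' | h'
      · rw [h', Real.rpow_zero]; linarith [h' ▸ hE]
      · rw [Real.zero_rpow h'.ne]; linarith
    · have hdet : IsUnit (Bf (A ω)).det := by
        by_contra hh
        rw [hf, Matrix.nonsing_inv_apply_not_isUnit _ hh] at h
        simp [specNorm] at h
      have h1 : 1 ≤ specNorm (Bf (A ω)) * f := by
        have : Nonempty (Fin n) := ⟨⟨0, hn0⟩⟩
        have h2 : specNorm (1 : Matrix (Fin n) (Fin n) ℝ) = 1 := by
          simp [specNorm]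
        rw [← h2, ← Matrix.mul_nonsing_inv _ hdet]
        unfold f specNorm
        rw [map_mul]
        exact norm_mul_le _ _
      have h3 : (|D| + 1)⁻¹ ≤ f := by
        rw [inv_le_iff_one_le_mul₀' (by positivity)]
        refine h1.trans ?_
        gcongr
        linarith [le_abs_self D]
      have h4 : f ^ p ≤ ((|D| + 1)⁻¹) ^ p :=
        Real.rpow_le_rpow_of_nonpos (by positivity) h3 hp0
      rw [Real.inv_rpow (by positivity), ← Real.rpow_neg (by positivity)] at h4
      linarith
  · choose M hM0 hM using fun j => badSet_volume κ hn j C hC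
    set q := Fintype.card κ - (n - 1) with hq
    have hqr : (q : ℝ) = Fintype.card κ - n + 1 := by
      have : q + n = Fintype.card κ + 1 := by omega
      have : (q : ℝ) + n = Fintype.card κ + 1 := by exact_mod_cast this
      linarith
    refine integrable_of_tail μ _ hmeas (fun ω => specNorm_nonneg _)
      (Cd.toReal * ((∑ j, M j) * ((n : ℝ) / β) ^ ((q : ℝ) / 2))) ((q : ℝ) / 2) p ?_ hp0
      (by linarith) ?_
    · have := Finset.sum_nonneg (fun j (_ : j ∈ Finset.univ) => hM0 j)
      positivity
    · intro s hs
      set t := Real.sqrt (n / (β * s)) with ht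
      have hsub : {ω | s < specNorm ((Bf (A ω))⁻¹)} ≤ᵐ[μ] ⋃ j, A ⁻¹' (badSet κ j C t) := by
        filter_upwards [hAC] with ω hω h
        obtain ⟨j, hj⟩ := mem_badSet_of_lt (A ω) (Bf (A ω)) β s C hβ hs (hB (A ω)) hω h
        exact Set.mem_iUnion.2 ⟨j, hj⟩
      have htq : t ^ q = (n / β) ^ ((q : ℝ) / 2) * s ^ (-((q : ℝ) / 2)) := by
        rw [ht, Real.sqrt_eq_rpow, ← Real.rpow_natCast, ← Real.rpow_mul (by positivity),
          ← div_div, Real.div_rpow (by positivity) hs.le, Real.rpow_neg hs.le, div_eq_mul_inv]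
        congr 2 <;> [skip; congr 1] <;> ring
      calc μ {ω | s < specNorm ((Bf (A ω))⁻¹)} ≤ μ (⋃ j, A ⁻¹' (badSet κ j C t)) :=
            measure_mono_ae hsub
        _ ≤ ∑ j, μ (A ⁻¹' (badSet κ j C t)) := measure_iUnion_fintype_le _ _
        _ ≤ ∑ j, ENNReal.ofReal (Cd.toReal * (M j * t ^ q)) := by
            apply Finset.sum_le_sum
            intro j _
            refine (hdens _ (badSet_compact κ j C t).measurableSet).trans ?_
            rw [ENNReal.ofReal_mul ENNReal.toReal_nonneg, ENNReal.ofReal_toReal hCd]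
            gcongr
            exact hM j t (Real.sqrt_nonneg _)
        _ = _ := by
            rw [← ENNReal.ofReal_sum_of_nonneg]
            · congr 1
              rw [htq, ← Finset.mul_sum, ← Finset.sum_mul]
              ring
            · intro j _
              have := hM0 j
              positivity

theorem moment_general {Ω : Type*} [MeasurableSpace Ω] (μ : Measure Ω) [IsProbabilityMeasure μ]
    {m n N : ℕ} (hmn : n ≤ N * m)
    (Jh : Fin N → Ω → Matrix (Fin m) (Fin n) ℝ)
    (hJ_meas : ∀ i, Measurable (Jh i))
    (C : ℝ)
    (hbdd : μ {ω | C < frobNorm (Matrix.of fun (p : Fin N × Fin m) (j : Fin n) =>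
        (Real.sqrt N)⁻¹ * Jh p.1 ω p.2 j)} = 0)
    (pdf : Matrix (Fin N × Fin m) (Fin n) ℝ → ENNReal)
    (hpdf : Measure.map (fun ω => Matrix.of fun (p : Fin N × Fin m) (j : Fin n) =>
        (Real.sqrt N)⁻¹ * Jh p.1 ω p.2 j) μ = MeasureTheory.volume.withDensity pdf)
    (Cd : ENNReal) (hCd : Cd ≠ ⊤) (hpdf_bdd : ∀ B, pdf B ≤ Cd)
    (coef : Fin N → ℝ) (a b : ℝ) (ha : 0 ≤ a) (hb : 0 < b) (p : ℝ) (hn0 : 0 < n)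
    (hp : p < ((m : ℝ) * N - n + 1) / 2) :
      Integrable (fun ω =>
        specNorm ((a • ((∑ i : Fin N, coef i • Jh i ω)ᵀ * ∑ i : Fin N, coef i • Jh i ω) +
          b • ((1 / (N : ℝ)) • ∑ i : Fin N, (Jh i ω)ᵀ * Jh i ω))⁻¹) ^ p) μ := by
  have hN : 0 < N := by
    rcases Nat.eq_zero_or_pos N with h | h
    · subst h; omega
    · exact h
  have hN' : (0 : ℝ) < N := by exact_mod_cast hN
  have hsN : Real.sqrt N ≠ 0 := (Real.sqrt_pos.2 hN').ne'
  let A : Ω → Fin N × Fin m → Fin n → ℝ := fun ω q j => (Real.sqrt N)⁻¹ * Jh q.1 ω q.2 j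
  have hA : Measurable A := by
    refine measurable_pi_iff.2 fun q => measurable_pi_iff.2 fun j => ?_
    have h1 : Measurable (fun ω => Jh q.1 ω q.2 j) :=
      (measurable_pi_apply j).comp ((measurable_pi_apply q.2).comp (hJ_meas q.1))
    exact h1.const_mul _
  let J : (Fin N × Fin m → Fin n → ℝ) → Fin N → Matrix (Fin m) (Fin n) ℝ :=
    fun M i => Matrix.of fun r c => Real.sqrt N * M (i, r) c
  have hJA : ∀ ω i, J (A ω) i = Jh i ω := by
    intro ω i
    ext r c
    simp only [J, A, Matrix.of_apply]
    field_simp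
  have hJc : ∀ i, Continuous (fun M => J M i) := by
    intro i
    refine continuous_matrix fun r c => ?_
    simp only [J, Matrix.of_apply]
    fun_prop
  let Bf : (Fin N × Fin m → Fin n → ℝ) → Matrix (Fin n) (Fin n) ℝ := fun M =>
    a • ((∑ i : Fin N, coef i • J M i)ᵀ * ∑ i : Fin N, coef i • J M i) +
          b • ((1 / (N : ℝ)) • ∑ i : Fin N, (J M i)ᵀ * J M i)
  have hBf : Continuous Bf := by
    have hG : Continuous (fun M => ∑ i : Fin N, coef i • J M i) :=
      continuous_finsetSum _ fun i _ => by
        have h := (hJc i).const_smul (coef i)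
        exact h
    have hR : Continuous (fun M => ∑ i : Fin N, (J M i)ᵀ * J M i) :=
      continuous_finsetSum _ fun i _ => (hJc i).matrix_transpose.matrix_mul (hJc i)
    have h1 := (hG.matrix_transpose.matrix_mul hG).const_smul a
    have h2 := (hR.const_smul (1 / (N : ℝ))).const_smul b
    exact h1.add h2
  have hquad : ∀ (k : ℕ) (G : Matrix (Fin k) (Fin n) ℝ) (x : Fin n → ℝ),
      x ⬝ᵥ (Gᵀ * G) *ᵥ x = ∑ r, (∑ i, G r i * x i) ^ 2 := by
    intro k G x
    rw [← Matrix.mulVec_mulVec, Matrix.dotProduct_mulVec, Matrix.vecMul_transpose]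
    simp only [dotProduct, Matrix.mulVec, sq]
  have hB : ∀ M, ∀ x : Fin n → ℝ, b * ∑ k, (∑ i, M k i * x i) ^ 2 ≤ x ⬝ᵥ Bf M *ᵥ x := by
    intro M x
    simp only [Bf, Matrix.add_mulVec, Matrix.smul_mulVec, dotProduct_add, dotProduct_smul,
      Matrix.sum_mulVec, dotProduct_sum, hquad, smul_eq_mul]
    have h1 : ∀ i r, (∑ c, J M i r c * x c) ^ 2 = N * (∑ c, M (i, r) c * x c) ^ 2 := by
      intro i r
      have : ∑ c, J M i r c * x c = Real.sqrt N * ∑ c, M (i, r) c * x c := by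
        rw [Finset.mul_sum]
        simp only [J, Matrix.of_apply, mul_assoc]
      rw [this, mul_pow, Real.sq_sqrt hN'.le]
    simp only [h1, ← Finset.mul_sum]
    rw [Fintype.sum_prod_type, ← mul_assoc (1 / (N : ℝ)), one_div_mul_cancel hN'.ne', one_mul]
    have h2 : 0 ≤ a * ∑ r, (∑ c, (∑ i, coef i • J M i) r c * x c) ^ 2 := by positivity
    linarith
  have hAC : ∀ᵐ ω ∂μ, ∀ k i, |A ω k i| ≤ |C| := by
    have h1 : ∀ᵐ ω ∂μ, ¬ (C < frobNorm (Matrix.of fun (p : Fin N × Fin m) (j : Fin n) =>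
        (Real.sqrt N)⁻¹ * Jh p.1 ω p.2 j)) := by
      rw [ae_iff]; simpa using hbdd
    filter_upwards [h1] with ω hω k i
    refine le_trans ?_ ((not_lt.1 hω).trans (le_abs_self C))
    unfold frobNorm
    apply Real.abs_le_sqrt
    refine le_trans ?_ (Finset.single_le_sum (f := fun k => ∑ j, (A ω k j) ^ 2)
      (fun k _ => Finset.sum_nonneg fun j _ => sq_nonneg _) (Finset.mem_univ k))
    exact Finset.single_le_sum (f := fun j => (A ω k j) ^ 2)
      (fun j _ => sq_nonneg _) (Finset.mem_univ i)
  have hdens : ∀ S : Set (Fin N × Fin m → Fin n → ℝ), MeasurableSet S →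
      μ (A ⁻¹' S) ≤ Cd * volume S := by
    intro S hS
    have h1 : μ (A ⁻¹' S) = (Measure.map A μ) S := (Measure.map_apply hA hS).symm
    let pdf' : (Fin N × Fin m → Fin n → ℝ) → ENNReal := fun M => pdf (Matrix.of M)
    have h2 : Measure.map A μ = (volume : Measure (Fin N × Fin m → Fin n → ℝ)).withDensity pdf' :=
      hpdf
    rw [h1, h2, withDensity_apply _ hS]
    calc ∫⁻ x in S, pdf' x ≤ ∫⁻ x in S, Cd := lintegral_mono fun x => hpdf_bdd (Matrix.of x)
      _ = _ := setLIntegral_const _ _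
  have hfin := core μ hn0 (by simpa using hmn) A hA |C| (abs_nonneg C) hAC Cd hCd hdens Bf hBf b hb hB
    p (by simp; linarith)
  simpa only [Bf, hJA] using hfin

/-- finite moments of regularized Gauss-Newton estimators:
if the stacked matrix `A = (1/√N)[Ĵ₁; …; Ĵ_N] ∈ ℝ^{Nm×n}` (with `Nm ≥ n`) is a.s. bounded in
Frobenius norm and has a bounded density, then `R⁻¹ = ((1/N) Σᵢ Ĵᵢᵀ Ĵᵢ)⁻¹ = (AᵀA)⁻¹` has a
finite `p`-th moment for every `p < (mN − n + 1)/2`; moreover for any coefficients `aᵢ`,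
any `a, b > 0`, the matrix `(a GᵀG + b R)⁻¹` with `G = Σᵢ aᵢ Ĵᵢ` has a finite `p`-th moment
whenever `N > (2p + n − 1)/m`. -/
theorem stmt11 {Ω : Type*} [MeasurableSpace Ω] (μ : Measure Ω) [IsProbabilityMeasure μ]
    {m n N : ℕ} (hmn : n ≤ N * m)
    (Jh : Fin N → Ω → Matrix (Fin m) (Fin n) ℝ)
    (hJ_meas : ∀ i, Measurable (Jh i))
    (C : ℝ)
    (hbdd : μ {ω | C < frobNorm (Matrix.of fun (p : Fin N × Fin m) (j : Fin n) =>
        (Real.sqrt N)⁻¹ * Jh p.1 ω p.2 j)} = 0)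
    (pdf : Matrix (Fin N × Fin m) (Fin n) ℝ → ENNReal)
    (hpdf : Measure.map (fun ω => Matrix.of fun (p : Fin N × Fin m) (j : Fin n) =>
        (Real.sqrt N)⁻¹ * Jh p.1 ω p.2 j) μ = MeasureTheory.volume.withDensity pdf)
    (Cd : ENNReal) (hCd : Cd ≠ ⊤) (hpdf_bdd : ∀ B, pdf B ≤ Cd) :
    (∀ p : ℝ, p < ((m : ℝ) * N - n + 1) / 2 →
      Integrable (fun ω =>
        specNorm (((1 / (N : ℝ)) • ∑ i : Fin N, (Jh i ω)ᵀ * Jh i ω)⁻¹) ^ p) μ) ∧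
    (∀ coef : Fin N → ℝ, ∀ a b : ℝ, 0 < a → 0 < b → ∀ p : ℝ,
      (2 * p + (n : ℝ) - 1) / (m : ℝ) < (N : ℝ) →
      Integrable (fun ω =>
        specNorm ((a • ((∑ i : Fin N, coef i • Jh i ω)ᵀ * ∑ i : Fin N, coef i • Jh i ω) +
          b • ((1 / (N : ℝ)) • ∑ i : Fin N, (Jh i ω)ᵀ * Jh i ω))⁻¹) ^ p) μ) := by
  have hzero : n = 0 → ∀ (F : Ω → Matrix (Fin n) (Fin n) ℝ) (p : ℝ),
      Integrable (fun ω => specNorm (F ω) ^ p) μ := by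
    intro h F p
    subst h
    have : (fun ω => specNorm (F ω) ^ p) =
        fun _ => specNorm (0 : Matrix (Fin 0) (Fin 0) ℝ) ^ p := by
      funext ω
      rw [Subsingleton.elim (F ω) 0]
    rw [this]
    exact integrable_const _
  rcases Nat.eq_zero_or_pos n with hn | hn
  · exact ⟨fun p _ => hzero hn _ p, fun coef a b _ _ p _ => hzero hn _ p⟩
  constructor
  · intro p hp
    have := moment_general μ hmn Jh hJ_meas C hbdd pdf hpdf Cd hCd hpdf_bdd (fun _ => 0) 0 1
      le_rfl one_pos p hn hp
    simpa only [zero_smul, zero_add, one_smul] using this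
  · intro coef a b ha hb p hp
    refine moment_general μ hmn Jh hJ_meas C hbdd pdf hpdf Cd hCd hpdf_bdd coef a b
      ha.le hb p hn ?_
    have hm : 0 < m := by
      rcases Nat.eq_zero_or_pos m with h | h
      · subst h; omega
      · exact h
    have hm' : (0 : ℝ) < m := by exact_mod_cast hm
    rw [div_lt_iff₀ hm'] at hp
    linarith
end
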